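/- Let (S, X, p) be a left étale action of an inverse semigroup S, and let S∗X be the associated right generalized inverse ∗-semigroup. Then the projection π_X : S∗X → S, (s,x) ↦ s, is a semigroup homomorphism and is étale: for every idempotent E of S∗X, π_X restricts to a bijection from (S∗X)·E = {A ∈ S∗X : A·E = A} onto S·π_X(E) = {s ∈ S : s·π_X(E) = s}. -/

import Mathlib

/-- `t` is a (von Neumann) inverse of `s`. -/
def IsInvOf {S : Type*} [Semigroup S] (t s : S) : Prop :=
  s * t * s = s ∧ t * s * t = t

/-- `e` is an idempotent. -/
def IsIdem {S : Type*} [Semigroup S] (e : S) : Prop := e * e = e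

/-- A right generalized inverse semigroup: every element is regular, the product of
idempotents is idempotent, and idempotents satisfy the right normality law `e*f*g = f*e*g`. -/
structure IsRGIS (S : Type*) [Semigroup S] : Prop where
  regular : ∀ s : S, ∃ t, IsInvOf t s
  idem_mul : ∀ e f : S, IsIdem e → IsIdem f → IsIdem (e * f)
  right_normal : ∀ e f g : S, IsIdem e → IsIdem f → IsIdem g → e * f * g = f * e * g

/-- A right ∗-semigroup structure: axioms (S1)-(S4). -/
structure IsRightStar (S : Type*) [Semigroup S] (star : S → S) : Prop where
  s1 : ∀ s : S, star (star s) = s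
  s2 : ∀ s : S, IsInvOf (star s) s
  s3 : ∀ s t : S, star (s * t) = star t * star (s * t * star t)
  s4 : ∀ e : S, IsIdem e → star e = e

/-- An inverse semigroup: `inv s` is an inverse of `s`, and inverses are unique. -/
structure IsInverseSemigroup (S : Type*) [Semigroup S] (inv : S → S) : Prop where
  inv_spec : ∀ s : S, IsInvOf (inv s) s
  inv_unique : ∀ s t : S, IsInvOf t s → t = inv s

/-- The relation γ : `a γ b` iff `V(a) ∩ V(b) ≠ ∅`. -/
def GammaRel {S : Type*} [Semigroup S] (a b : S) : Prop :=
  ∃ t, IsInvOf t a ∧ IsInvOf t b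

/-- The natural partial order on a regular semigroup. -/
def NatLe {S : Type*} [Semigroup S] (a b : S) : Prop :=
  ∃ e f : S, IsIdem e ∧ IsIdem f ∧ a = e * b ∧ a = b * f

/-- Green's L relation. -/
def GreenL {S : Type*} [Semigroup S] (a b : S) : Prop :=
  a = b ∨ ∃ x y : S, a = x * b ∧ b = y * a

/-- An étale homomorphism: for every idempotent `e` of `T`, `θ` restricts to a bijection
from `T·e` onto `S·θ(e)`. -/
def IsEtaleHom {T S : Type*} [Semigroup T] [Semigroup S] (θ : T → S) : Prop :=
  ∀ e : T, IsIdem e →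
    (∀ a b : T, a * e = a → b * e = b → θ a = θ b → a = b) ∧
    (∀ s : S, s * θ e = s → ∃ a : T, a * e = a ∧ θ a = s)

section SX

variable {S X : Type*} [Semigroup S]

/-- Membership in `S∗X = {(s,x) : s⁻¹s = p(x)}`. -/
def memSX (inv : S → S) (p : X → S) (a : S × X) : Prop :=
  inv a.1 * a.1 = p a.2

/-- The multiplication `(s,x)(t,y) = (st, ((st)⁻¹(st))·y)` on `S∗X`. -/
def mulSX (inv : S → S) (act : S → X → X) (a b : S × X) : S × X :=
  (a.1 * b.1, act (inv (a.1 * b.1) * (a.1 * b.1)) b.2)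

/-- The unary operation `(s,x)∗ = (s⁻¹, s·x)` on `S∗X`. -/
def starSX (inv : S → S) (act : S → X → X) (a : S × X) : S × X :=
  (inv a.1, act a.1 a.2)

end SX

/-- An idempotent of an inverse semigroup is its own inverse. -/
theorem IsInverseSemigroup.inv_eq_self {S : Type*} [Semigroup S] {inv : S → S}
    (hS : IsInverseSemigroup S inv) {e : S} (he : IsIdem e) : inv e = e := by
  have he' : e * e = e := he
  exact (hS.inv_unique e e ⟨by rw [he', he'], by rw [he', he']⟩).symm

theorem IsInverseSemigroup.isIdem_inv_mul {S : Type*} [Semigroup S] {inv : S → S}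
    (hS : IsInverseSemigroup S inv) (s : S) : IsIdem (inv s * s) := by
  rw [IsIdem, ← mul_assoc, (hS.inv_spec s).2]

/-- Proposition 2.5(3): the projection `π_X : S∗X → S`, `(s,x) ↦ s`, is a semigroup
homomorphism and is étale. -/
theorem sx_projection_etale {S X : Type*} [Semigroup S]
    (inv : S → S) (hS : IsInverseSemigroup S inv)
    (p : X → S) (act : S → X → X)
    (hp : ∀ x : X, IsIdem (p x))
    (hassoc : ∀ (s t : S) (x : X), act (s * t) x = act s (act t x))
    (he1 : ∀ x : X, act (p x) x = x)
    (he2 : ∀ (s : S) (x : X), p (act s x) = s * p x * inv s) :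
    -- π_X is a homomorphism
    (∀ a b : S × X, memSX inv p a → memSX inv p b →
      (mulSX inv act a b).1 = a.1 * b.1) ∧
    -- π_X is étale
    (∀ E : S × X, memSX inv p E → mulSX inv act E E = E →
      (∀ A B : S × X, memSX inv p A → memSX inv p B →
        mulSX inv act A E = A → mulSX inv act B E = B → A.1 = B.1 → A = B) ∧
      (∀ s : S, s * E.1 = s →
        ∃ A : S × X, memSX inv p A ∧ mulSX inv act A E = A ∧ A.1 = s)) := by
  refine ⟨fun _ _ _ _ => rfl, fun E hE hEE => ⟨fun A B _ _ hA hB hAB => ?_, fun s hs => ?_⟩⟩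
  · rw [← hA, ← hB, mulSX, mulSX, hAB]
  · have hidem : IsIdem E.1 := congrArg Prod.fst hEE
    have hpE : p E.2 = E.1 := by
      rw [← show inv E.1 * E.1 = p E.2 from hE, hS.inv_eq_self hidem, hidem]
    refine ⟨(s, act (inv s * s) E.2), ?_, ?_, rfl⟩
    · change inv s * s = p (act (inv s * s) E.2)
      rw [he2, hpE, hS.inv_eq_self (hS.isIdem_inv_mul s), mul_assoc (inv s) s E.1, hs]
      exact (hS.isIdem_inv_mul s).symm
    · simp only [mulSX, hs]
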